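/- arXiv:1507.02733 — 3 statements merged into one kernel-verified Lean document; each statement's English description precedes it below -/
import Mathlib

section
/- Let n ≥ 1 and let f₁, …, fₙ ∈ K = ℂ((t)) each have pole order at most 1, i.e. fᵢ.coeff k = 0 for all k < −1. Let a₁, …, aₙ ∈ K be the unique Laurent series with (∂ + M_{f₁}) ∘ ⋯ ∘ (∂ + M_{fₙ}) = ∂ⁿ + M_{a₁}∘∂^{n−1} + ⋯ + M_{aₙ} as ℂ-linear endomorphisms of K. Then for each ℓ ∈ {1,…,n}, the coefficient a_ℓ has pole order at most ℓ, i.e. a_ℓ.coeff k = 0 for all k < −ℓ. (In converting the product of first-order operators to a sum, the order of poles can only decrease.) -/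
instance : SMulCommClass ℂ (LaurentSeries ℂ) (LaurentSeries ℂ) where
  smul_comm c f g := by
    show c • (f * g) = f * (c • g)
    rw [← HahnSeries.single_zero_mul_eq_smul, ← HahnSeries.single_zero_mul_eq_smul, mul_left_comm]

instance : IsScalarTower ℂ (LaurentSeries ℂ) (LaurentSeries ℂ) where
  smul_assoc c f g := by
    show (c • f) * g = c • (f * g)
    rw [← HahnSeries.single_zero_mul_eq_smul, ← HahnSeries.single_zero_mul_eq_smul, mul_assoc]


/-- Vanishing bounds on the coefficients of Laurent series add under multiplication. -/
theorem LaurentSeries.coeff_mul_eq_zero_of_lt {f g : LaurentSeries ℂ} {p q : ℤ}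
    (hf : ∀ k < p, f.coeff k = 0) (hg : ∀ k < q, g.coeff k = 0) :
    ∀ k < p + q, (f * g).coeff k = 0 := by
  intro k hk
  rw [HahnSeries.coeff_mul]
  refine Finset.sum_eq_zero fun x hx => ?_
  have hx' := (Finset.mem_antidiagonal.mp hx).2.2
  rcases lt_or_ge x.1 p with h | h
  · rw [hf _ h, zero_mul]
  · rw [hg x.2 (by lia), mul_zero]

/-- A product of first-order operators with at most simple poles lowers the order of vanishing by
at most the number of factors. -/
theorem LaurentSeries.coeff_list_prod_eq_zero_of_lt {d : Module.End ℂ (LaurentSeries ℂ)}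
    (hd : ∀ (f : LaurentSeries ℂ) (k : ℤ),
      (d f).coeff k = ((k + 1 : ℤ) : ℂ) * f.coeff (k + 1))
    (L : List (LaurentSeries ℂ)) (hL : ∀ f ∈ L, ∀ k < -1, f.coeff k = 0)
    {g : LaurentSeries ℂ} {m : ℤ} (hg : ∀ k < m, g.coeff k = 0) :
    ∀ k < m - L.length, ((L.map fun f => d + LinearMap.mulLeft ℂ f).prod g).coeff k = 0 := by
  induction L with
  | nil => simpa using hg
  | cons f L ih =>
    intro k hk
    have hih := ih fun f' hf' => hL f' (List.mem_cons_of_mem _ hf')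
    rw [List.length_cons] at hk
    push_cast at hk
    rw [List.map_cons, List.prod_cons, Module.End.mul_apply, LinearMap.add_apply,
      LinearMap.mulLeft_apply, HahnSeries.coeff_add, hd, hih _ (by lia), mul_zero, zero_add]
    exact coeff_mul_eq_zero_of_lt (hL f List.mem_cons_self) hih k (by lia)

/-- The iterated formal derivative of a monomial. -/
theorem LaurentSeries.pow_derivative_single {d : Module.End ℂ (LaurentSeries ℂ)}
    (hd : ∀ (f : LaurentSeries ℂ) (k : ℤ),
      (d f).coeff k = ((k + 1 : ℤ) : ℂ) * f.coeff (k + 1)) (i j : ℕ) :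
    (d ^ i) (HahnSeries.single (j : ℤ) 1) =
      HahnSeries.single ((j : ℤ) - i) (j.descFactorial i : ℂ) := by
  induction i with
  | zero => simp
  | succ i ih =>
    rw [pow_succ', Module.End.mul_apply, ih]
    ext k
    rw [hd]
    by_cases hk : k = (j : ℤ) - (i + 1 : ℕ)
    · subst hk
      rw [show (j : ℤ) - (i + 1 : ℕ) + 1 = j - i by push_cast; ring,
        HahnSeries.coeff_single_same, HahnSeries.coeff_single_same, Nat.descFactorial_succ]
      rcases le_or_gt i j with h | h
      · push_cast [h]
        ring
      · simp [Nat.descFactorial_of_lt h]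
    · rw [HahnSeries.coeff_single_of_ne hk,
        HahnSeries.coeff_single_of_ne (by push_cast at hk; lia), mul_zero]

/-- Let `f₁, …, fₙ ∈ K = ℂ((t))` have pole order at most 1, and let `a₁, …, aₙ` be the
coefficients of `(∂ + M_{f₁}) ∘ ⋯ ∘ (∂ + M_{fₙ}) = ∂ⁿ + M_{a₁}∘∂^{n−1} + ⋯ + M_{aₙ}`.
Then `a_ℓ` has pole order at most `ℓ`. Here `a i` stands for `a_{i+1}` (with `∂`-exponent
`n − 1 − i`), so the conclusion reads: `(a i).coeff k = 0` for `k < −(i+1)`. -/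
theorem pole_order_of_miura (n : ℕ) (hn : 1 ≤ n)
    (d : Module.End ℂ (LaurentSeries ℂ))
    (hd : ∀ (f : LaurentSeries ℂ) (k : ℤ),
      (d f).coeff k = ((k + 1 : ℤ) : ℂ) * f.coeff (k + 1))
    (f a : Fin n → LaurentSeries ℂ)
    (hf : ∀ i : Fin n, ∀ k : ℤ, k < -1 → (f i).coeff k = 0)
    (ha : (List.ofFn fun i : Fin n => d + LinearMap.mulLeft ℂ (f i)).prod =
        d ^ n + ∑ i : Fin n, (LinearMap.mulLeft ℂ (a i)) * d ^ (n - 1 - (i : ℕ))) :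
    ∀ i : Fin n, ∀ k : ℤ, k < -((i : ℤ) + 1) → (a i).coeff k = 0 := by
  have key : ∀ j : ℕ, ∀ i : Fin n, n - 1 - (i : ℕ) = j →
      ∀ k : ℤ, k < (j : ℤ) - n → (a i).coeff k = 0 := by
    intro j
    induction j using Nat.strong_induction_on with
    | _ j ih =>
      intro i hij k hk
      have hi := i.isLt
      have hP := LaurentSeries.coeff_list_prod_eq_zero_of_lt hd (List.ofFn f)
        (by simpa [List.mem_ofFn] using hf)
        (g := HahnSeries.single (j : ℤ) 1) (m := j)
        (fun k hk => HahnSeries.coeff_single_of_ne hk.ne)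
        k (by simpa using hk)
      rw [List.map_ofFn] at hP
      change ((List.ofFn fun i : Fin n => d + LinearMap.mulLeft ℂ (f i)).prod _).coeff k = 0 at hP
      rw [ha, LinearMap.add_apply, LinearMap.sum_apply,
        LaurentSeries.pow_derivative_single hd, Nat.descFactorial_of_lt (by lia),
        Nat.cast_zero, HahnSeries.single_eq_zero, zero_add, HahnSeries.coeff_sum,
        Finset.sum_eq_single i] at hP
      · rw [Module.End.mul_apply, LaurentSeries.pow_derivative_single hd, hij,
          LinearMap.mulLeft_apply, sub_self, Nat.descFactorial_self,
          HahnSeries.coeff_mul_single_zero] at hP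
        exact (mul_eq_zero.mp hP).resolve_right (by exact_mod_cast j.factorial_ne_zero)
      · intro b _ hbi
        have hb := b.isLt
        have hne : (b : ℕ) ≠ i := fun h => hbi (Fin.ext h)
        rw [Module.End.mul_apply, LaurentSeries.pow_derivative_single hd,
          LinearMap.mulLeft_apply]
        rcases lt_or_ge (n - 1 - (b : ℕ)) j with h | h
        · exact LaurentSeries.coeff_mul_eq_zero_of_lt (ih _ h b rfl)
            (fun k hk => HahnSeries.coeff_single_of_ne hk.ne) k (by lia)
        · rw [Nat.descFactorial_of_lt (by lia), Nat.cast_zero, HahnSeries.single_eq_zero,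
            mul_zero, HahnSeries.coeff_zero]
      · simp
  intro i k hk
  have hi := i.isLt
  exact key _ i rfl k (by lia)
end

section
/- Let n ≥ 1, let R be an associative unital ℂ-algebra, τ ∈ R, and e : Fin n → Fin n → ℤ → R a family of elements satisfying τ * (e i j p) − (e i j p) * τ = (−p) • e i j (p−1) for all i, j and p ∈ ℤ. Let M be the n×n matrix over R with entries M i j = (if i = j then τ else 0) + e i j (−1). Then there exist S₁, …, Sₙ ∈ R such that cdet M = τⁿ + τ^{n−1} * S₁ + τ^{n−2} * S₂ + ⋯ + τ * S_{n−1} + Sₙ, and moreover each S_ℓ lies in the ℂ-linear span of the set of products e i₁ j₁ u₁ * e i₂ j₂ u₂ * ⋯ * e iₖ jₖ uₖ with 1 ≤ k ≤ ℓ, all uₜ < 0, u₁ + ⋯ + uₖ = −ℓ, and at most one index t ∈ {1,…,k} for which iₜ is the last element n of Fin n. -/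
/-- The column determinant of a matrix over a (possibly noncommutative) ring:
`cdet M = Σ_σ sgn(σ) • M(σ(1),1) * M(σ(2),2) * ⋯ * M(σ(n),n)`,
the factors being multiplied in column order. -/
noncomputable def cdet {R : Type*} [Ring R] {n : ℕ} (M : Matrix (Fin n) (Fin n) R) : R :=
  ∑ σ : Equiv.Perm (Fin n),
    (Equiv.Perm.sign σ : ℤ) • (List.ofFn fun j : Fin n => M (σ j) j).prod

/-- The `K`-span of the monomials `e_{i₁j₁}[u₁] ⋯ e_{iₖjₖ}[uₖ]` with negative exponents summing to
`-w` and at most `b` row indices equal to `r`. -/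
def loopSpan (K : Type*) {R ι : Type*} [CommRing K] [Ring R] [Algebra K R] [DecidableEq ι]
    (e : ι → ι → ℤ → R) (r : ι) (b : ℕ) (w : ℤ) : Submodule K R :=
  Submodule.span K {y | ∃ l : List (ι × ι × ℤ), (∀ x ∈ l, x.2.2 < 0) ∧
    (l.map fun x => x.2.2).sum = -w ∧ (l.map Prod.fst).count r ≤ b ∧
    y = (l.map fun x => e x.1 x.2.1 x.2.2).prod}

section LoopSpan

variable {K R ι : Type*} [CommRing K] [Ring R] [Algebra K R] [DecidableEq ι]
  {e : ι → ι → ℤ → R} {r : ι} {b b' : ℕ} {w w' : ℤ} {x y τ : R}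

theorem loopSpan_mono (h : b ≤ b') : loopSpan K e r b w ≤ loopSpan K e r b' w := by
  refine Submodule.span_mono ?_
  rintro y ⟨l, h1, h2, h3, rfl⟩
  exact ⟨l, h1, h2, h3.trans h, rfl⟩

theorem one_mem_loopSpan : (1 : R) ∈ loopSpan K e r b 0 :=
  Submodule.subset_span ⟨[], by simp⟩

theorem entry_mem_loopSpan (i j : ι) {p : ℤ} (hp : p < 0) :
    e i j p ∈ loopSpan K e r (if i = r then 1 else 0) (-p) :=
  Submodule.subset_span ⟨[(i, j, p)], by simp [hp, List.count_singleton]⟩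

theorem mul_mem_loopSpan (hx : x ∈ loopSpan K e r b w) (hy : y ∈ loopSpan K e r b' w') :
    x * y ∈ loopSpan K e r (b + b') (w + w') := by
  have h := Submodule.mul_mem_mul hx hy
  rw [loopSpan, loopSpan, Submodule.span_mul_span] at h
  refine Submodule.span_mono ?_ h
  rintro _ ⟨_, ⟨l, h1, h2, h3, rfl⟩, _, ⟨l', h1', h2', h3', rfl⟩, rfl⟩
  refine ⟨l ++ l', fun x hx => ?_, ?_, ?_, by simp⟩
  · exact (List.mem_append.1 hx).elim (h1 x) (h1' x)
  · rw [List.map_append, List.sum_append, h2, h2']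
    ring
  · rw [List.map_append, List.count_append]
    exact add_le_add h3 h3'

theorem prod_commutator_mem_loopSpan
    (hτ : ∀ (i j : ι) (p : ℤ), τ * e i j p - e i j p * τ = (-p) • e i j (p - 1))
    (l : List (ι × ι × ℤ)) (hl : ∀ x ∈ l, x.2.2 < 0) :
    (l.map fun x => e x.1 x.2.1 x.2.2).prod * τ - τ * (l.map fun x => e x.1 x.2.1 x.2.2).prod ∈
      loopSpan K e r ((l.map Prod.fst).count r) (1 - (l.map fun x => x.2.2).sum) := by
  induction l with
  | nil => simp
  | cons x l ih =>
    obtain ⟨i, j, p⟩ := x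
    have hp : p < 0 := hl (i, j, p) (by simp)
    have hl' : ∀ x ∈ l, x.2.2 < 0 := fun x hx => hl x (by simp [hx])
    set m := (l.map fun x => e x.1 x.2.1 x.2.2).prod with hm
    have hmem : m ∈ loopSpan K e r ((l.map Prod.fst).count r) (-(l.map fun x => x.2.2).sum) :=
      Submodule.subset_span ⟨l, hl', by simp, le_rfl, rfl⟩
    have hcomm : e i j p * τ - τ * e i j p ∈
        loopSpan K e r (if i = r then 1 else 0) (-(p - 1)) := by
      rw [← neg_sub (τ * e i j p), hτ, ← neg_smul]
      exact zsmul_mem (entry_mem_loopSpan i j (by omega)) _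
    have h1 := mul_mem_loopSpan (entry_mem_loopSpan (K := K) (e := e) (r := r) i j hp) (ih hl')
    have h2 := mul_mem_loopSpan hcomm hmem
    have hb : (List.map Prod.fst ((i, j, p) :: l)).count r =
        (if i = r then 1 else 0) + (l.map Prod.fst).count r := by
      simp [List.count_cons, add_comm]
    rw [hb]
    simp only [List.map_cons, List.prod_cons, List.sum_cons, ← hm]
    have hsplit : e i j p * m * τ - τ * (e i j p * m) =
        e i j p * (m * τ - τ * m) + (e i j p * τ - τ * e i j p) * m := by noncomm_ring
    rw [hsplit]
    refine add_mem ?_ ?_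
    · convert h1 using 2
      ring
    · convert h2 using 2
      ring

theorem commutator_mem_loopSpan
    (hτ : ∀ (i j : ι) (p : ℤ), τ * e i j p - e i j p * τ = (-p) • e i j (p - 1))
    (hy : y ∈ loopSpan K e r b w) : y * τ - τ * y ∈ loopSpan K e r b (w + 1) := by
  induction hy using Submodule.span_induction with
  | mem y hy =>
    obtain ⟨l, h1, h2, h3, rfl⟩ := hy
    have h := loopSpan_mono h3 (prod_commutator_mem_loopSpan (K := K) (r := r) hτ l h1)
    rw [h2] at h
    convert h using 2
    ring
  | zero => simp
  | add x y _ _ hx hy =>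
    convert add_mem hx hy using 1
    noncomm_ring
  | smul a x _ hx =>
    convert Submodule.smul_mem _ a hx using 1
    rw [smul_sub, smul_mul_assoc, mul_smul_comm]

/-- `x = c τ^d + τ^{d-1} S₁ + ⋯ + S_d` with `S_ℓ` in `loopSpan K e r b ℓ`. -/
def IsNormalOrdered (K : Type*) {R ι : Type*} [CommRing K] [Ring R] [Algebra K R] [DecidableEq ι]
    (e : ι → ι → ℤ → R) (r : ι) (τ : R) (b d : ℕ) (c : ℤ) (x : R) : Prop :=
  ∃ S : ℕ → R, S 0 = c ∧ (∀ ℓ : ℕ, S ℓ ∈ loopSpan K e r b ℓ) ∧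
    x = ∑ i ∈ Finset.range (d + 1), τ ^ (d - i) * S i

variable {d : ℕ} {c c' : ℤ}

theorem IsNormalOrdered.mono (h : b ≤ b') (hx : IsNormalOrdered K e r τ b d c x) :
    IsNormalOrdered K e r τ b' d c x := by
  obtain ⟨S, h0, hS, rfl⟩ := hx
  exact ⟨S, h0, fun ℓ => loopSpan_mono h (hS ℓ), rfl⟩

theorem isNormalOrdered_zero : IsNormalOrdered K e r τ b d 0 0 :=
  ⟨0, by simp⟩

theorem isNormalOrdered_one : IsNormalOrdered K e r τ b 0 1 1 := by
  refine ⟨fun ℓ => if ℓ = 0 then 1 else 0, by simp, fun ℓ => ?_, by simp⟩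
  by_cases h : ℓ = 0
  · subst h
    simpa using one_mem_loopSpan
  · simp [h]

theorem IsNormalOrdered.add (hx : IsNormalOrdered K e r τ b d c x)
    (hy : IsNormalOrdered K e r τ b d c' y) : IsNormalOrdered K e r τ b d (c + c') (x + y) := by
  obtain ⟨S, h0, hS, rfl⟩ := hx
  obtain ⟨T, h0', hT, rfl⟩ := hy
  refine ⟨S + T, by simp [h0, h0'], fun ℓ => add_mem (hS ℓ) (hT ℓ), ?_⟩
  simp [mul_add, Finset.sum_add_distrib]

theorem IsNormalOrdered.zsmul (a : ℤ) (hx : IsNormalOrdered K e r τ b d c x) :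
    IsNormalOrdered K e r τ b d (a * c) (a • x) := by
  obtain ⟨S, h0, hS, rfl⟩ := hx
  refine ⟨a • S, by simp [h0], fun ℓ => zsmul_mem (hS ℓ) a, ?_⟩
  simp only [Finset.smul_sum, Pi.smul_apply, mul_smul_comm]

theorem isNormalOrdered_sum {κ : Type*} (s : Finset κ) {f : κ → R} {c : κ → ℤ}
    (h : ∀ k ∈ s, IsNormalOrdered K e r τ b d (c k) (f k)) :
    IsNormalOrdered K e r τ b d (∑ k ∈ s, c k) (∑ k ∈ s, f k) := by
  classical
  induction s using Finset.induction_on with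
  | empty => simpa using isNormalOrdered_zero
  | insert k s hk ih =>
    rw [Finset.sum_insert hk, Finset.sum_insert hk]
    exact (h k (by simp)).add (ih fun k hk => h k (by simp [hk]))

theorem IsNormalOrdered.mul_entry (i j : ι) (hx : IsNormalOrdered K e r τ b d c x) :
    IsNormalOrdered K e r τ (b + if i = r then 1 else 0) (d + 1) 0 (x * e i j (-1)) := by
  obtain ⟨S, h0, hS, rfl⟩ := hx
  refine ⟨fun ℓ => ℓ.casesOn 0 fun m => S m * e i j (-1), by simp, fun ℓ => ?_, ?_⟩
  · cases ℓ with
    | zero => simp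
    | succ m =>
      simpa using mul_mem_loopSpan (hS m) (entry_mem_loopSpan i j (by norm_num : (-1 : ℤ) < 0))
  · rw [Finset.sum_range_succ' _ (d + 1), Finset.sum_mul]
    simp [mul_assoc]

theorem IsNormalOrdered.mul_right
    (hτ : ∀ (i j : ι) (p : ℤ), τ * e i j p - e i j p * τ = (-p) • e i j (p - 1))
    (hx : IsNormalOrdered K e r τ b d c x) :
    IsNormalOrdered K e r τ b (d + 1) c (x * τ) := by
  obtain ⟨S, h0, hS, rfl⟩ := hx
  let T : ℕ → R := fun ℓ => if ℓ ≤ d then S ℓ else 0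
  let D : ℕ → R := fun ℓ => ℓ.casesOn 0 fun m => S m * τ - τ * S m
  have hD0 : D 0 = 0 := rfl
  have hD (m : ℕ) : D (m + 1) = S m * τ - τ * S m := rfl
  refine ⟨fun ℓ => T ℓ + D ℓ, by simp [T, h0, hD0],
    fun ℓ => add_mem ?_ ?_, ?_⟩
  · by_cases h : ℓ ≤ d
    · simpa [T, h] using hS ℓ
    · simp [T, h]
  · cases ℓ with
    | zero => simp [hD0]
    | succ m => simpa [hD] using commutator_mem_loopSpan hτ (hS m)
  · simp only [mul_add, Finset.sum_add_distrib]
    rw [Finset.sum_range_succ (fun i => τ ^ (d + 1 - i) * T i),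
      Finset.sum_range_succ' (fun i => τ ^ (d + 1 - i) * D i), Finset.sum_mul]
    have hT : T (d + 1) = 0 := by simp [T]
    simp only [hT, hD0, hD, mul_zero, add_zero]
    rw [← Finset.sum_add_distrib]
    refine Finset.sum_congr rfl fun i hi => ?_
    have hi' : i ≤ d := Nat.lt_succ_iff.1 (Finset.mem_range.1 hi)
    simp only [T, hi', if_true, Nat.add_sub_add_right, Nat.succ_sub hi', pow_succ]
    noncomm_ring

theorem isNormalOrdered_list_prod
    (hτ : ∀ (i j : ι) (p : ℤ), τ * e i j p - e i j p * τ = (-p) • e i j (p - 1))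
    (l : List (ι × ι)) :
    IsNormalOrdered K e r τ ((l.map Prod.fst).count r) l.length
      (l.map fun q => if q.1 = q.2 then 1 else 0).prod
      (l.map fun q => (if q.1 = q.2 then τ else 0) + e q.1 q.2 (-1)).prod := by
  induction l using List.reverseRecOn with
  | nil => simpa using isNormalOrdered_one
  | append_singleton l q ih =>
    obtain ⟨i, j⟩ := q
    have hb : ((l ++ [(i, j)]).map Prod.fst).count r =
        (l.map Prod.fst).count r + if i = r then 1 else 0 := by
      simp [List.count_singleton]
    rw [hb]
    simp only [List.map_append, List.map_cons, List.map_nil, List.prod_append, List.prod_singleton,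
      List.length_append, List.length_singleton]
    have h1 := ih.mul_entry i j
    by_cases hij : i = j
    · simpa [hij, mul_add] using ((ih.mul_right hτ).mono (Nat.le_add_right _ _)).add h1
    · simpa [hij] using h1

end LoopSpan

theorem isNormalOrdered_cdet {K R : Type*} [CommRing K] [Ring R] [Algebra K R] {N : ℕ} {τ : R}
    {e : Fin N → Fin N → ℤ → R} (r : Fin N)
    (hτ : ∀ (i j : Fin N) (p : ℤ), τ * e i j p - e i j p * τ = (-p) • e i j (p - 1)) :
    IsNormalOrdered K e r τ 1 N 1
      (cdet (Matrix.of fun i j : Fin N => (if i = j then τ else 0) + e i j (-1))) := by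
  have hdet : ∑ σ : Equiv.Perm (Fin N), (Equiv.Perm.sign σ : ℤ) *
      ∏ j, (if σ j = j then 1 else 0) = 1 := by
    have h := Matrix.det_apply' (1 : Matrix (Fin N) (Fin N) ℤ)
    rw [Matrix.det_one] at h
    simpa [Matrix.one_apply] using h.symm
  have hσ (σ : Equiv.Perm (Fin N)) := by
    have h := isNormalOrdered_list_prod (K := K) (r := r) hτ (List.ofFn fun j => (σ j, j))
    simp only [List.map_ofFn, Function.comp_def, List.length_ofFn, List.prod_ofFn] at h
    exact (h.mono (List.nodup_iff_count_le_one.1 (List.nodup_ofFn.2 σ.injective) r)).zsmul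
      (Equiv.Perm.sign σ : ℤ)
  have h := isNormalOrdered_sum Finset.univ fun σ _ => hσ σ
  rw [hdet] at h
  exact h

theorem length_le_neg_sum_of_neg (l : List ℤ) (h : ∀ x ∈ l, x < 0) : (l.length : ℤ) ≤ -l.sum := by
  have := List.sum_le_card_nsmul l (-1) fun x hx => by have := h x hx; omega
  simp at this
  omega

/-- Chervov–Molev–Talalaev Segal–Sugawara vectors for `gl_{n+1}`: if
`[τ, e_{ij}[p]] = −p·e_{ij}[p−1]`, then `cdet(τ·I + E[−1]) = τ^{n+1} + τ^n S₁ + ⋯ + S_{n+1}`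
for some `S₁, …, S_{n+1}`, and each `S_ℓ` lies in the ℂ-span of ordered monomials
`e_{i₁j₁}[u₁] ⋯ e_{iₖjₖ}[uₖ]` with `1 ≤ k ≤ ℓ`, all `uₜ < 0` summing to `−ℓ`, and at most one
row index `iₜ` equal to the last index. Here `S i` stands for `S_{i+1}` (with `τ`-exponent
`n − i`), and `ℓ = (ℓidx : Fin (n+1)) + 1`. -/
theorem cdet_segal_sugawara (n : ℕ)
    {R : Type*} [Ring R] [Algebra ℂ R]
    (τ : R) (e : Fin (n + 1) → Fin (n + 1) → ℤ → R)
    (hτ : ∀ (i j : Fin (n + 1)) (p : ℤ),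
      τ * e i j p - e i j p * τ = (-p) • e i j (p - 1)) :
    ∃ S : Fin (n + 1) → R,
      cdet (Matrix.of fun i j : Fin (n + 1) => (if i = j then τ else 0) + e i j (-1)) =
          τ ^ (n + 1) + ∑ i : Fin (n + 1), τ ^ (n - (i : ℕ)) * S i ∧
      ∀ ℓidx : Fin (n + 1), S ℓidx ∈ Submodule.span ℂ
        {y : R | ∃ (k : ℕ) (_ : 1 ≤ k) (_ : k ≤ (ℓidx : ℕ) + 1)
            (ii jj : Fin k → Fin (n + 1)) (u : Fin k → ℤ),
          (∀ t, u t < 0) ∧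
          (∑ t, u t = -(((ℓidx : ℕ) : ℤ) + 1)) ∧
          (∀ t t' : Fin k, ii t = Fin.last n → ii t' = Fin.last n → t = t') ∧
          y = (List.ofFn fun t : Fin k => e (ii t) (jj t) (u t)).prod} := by
  obtain ⟨S, h0, hS, hx⟩ := isNormalOrdered_cdet (K := ℂ) (Fin.last n) hτ
  refine ⟨fun i => S (i + 1), ?_, fun ℓ => ?_⟩
  · rw [hx, Finset.sum_range_succ', Finset.sum_range]
    simp [h0, add_comm]
  · refine Submodule.span_mono ?_ (hS (ℓ + 1))
    rintro y ⟨l, h1, h2, h3, rfl⟩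
    have hlen := length_le_neg_sum_of_neg (l.map fun x => x.2.2)
      (List.forall_mem_map.2 h1)
    rw [h2, List.length_map] at hlen
    refine ⟨l.length, List.length_pos_iff.2 ?_, by push_cast at hlen; omega, fun t => (l.get t).1,
      fun t => (l.get t).2.1, fun t => (l.get t).2.2, fun t => h1 _ (l.get_mem t), ?_, ?_, ?_⟩
    · rintro rfl
      simp at h2
      omega
    · rw [← List.sum_ofFn, ← Nat.cast_succ, ← h2]
      exact congrArg List.sum (List.ofFn_getElem_eq_map l fun x => x.2.2)
    · intro t t' ht ht'
      by_contra hne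
      have hdup : List.Duplicate (Fin.last n) (l.map Prod.fst) := by
        rw [List.duplicate_iff_exists_distinct_get]
        rcases lt_or_gt_of_ne hne with hlt | hlt
        · exact ⟨t.cast (by simp), t'.cast (by simp), hlt, by simpa using ht.symm,
            by simpa using ht'.symm⟩
        · exact ⟨t'.cast (by simp), t.cast (by simp), hlt, by simpa using ht'.symm,
            by simpa using ht.symm⟩
      have := List.duplicate_iff_two_le_count.1 hdup
      omega
    · exact congrArg List.prod (List.ofFn_getElem_eq_map l fun x => e x.1 x.2.1 x.2.2).symm
end

section
/- Let M be a left R-module and v ∈ M a vector satisfying x i j s • v = 0 for all i, j ∈ Fin n and all s ≥ r(i,j). Then for every ℓ ∈ {1,…,n}, every k with 1 ≤ k ≤ ℓ, every list of pairs (i₁,j₁), …, (iₖ,jₖ) ∈ Fin n × Fin n such that at most one t has iₜ = n, all negative integers u₁, …, uₖ with u₁ + ⋯ + uₖ = −ℓ, and all integers s₁, …, sₖ with s₁ + ⋯ + sₖ ≥ m + ℓ − 1, one has (x i₁ j₁ (u₁ + s₁ + 1)) * (x i₂ j₂ (u₂ + s₂ + 1)) * ⋯ * (x iₖ jₖ (uₖ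 + sₖ + 1)) • v = 0. (This expresses that the N-th Fourier coefficients S_{ℓ,[N]} of the Chervov–Molev–Talalaev Segal–Sugawara vectors annihilate every vector killed by the subalgebra 𝔨_m⁰, for all N ≥ m + ℓ − 1.) -/
section

variable {ι : Type*} [DecidableEq ι]

/-- If the mode `a.2.2` of each letter of a word is at most `m - 1` in row `o` and at most `0` in
the other rows, then the total mode is at most `m - 1` times the number of letters in row `o`. -/
theorem sum_modes_le_mul_countP (m : ℤ) (o : ι) (L : List (ι × ι × ℤ))
    (h : ∀ a ∈ L, a.2.2 ≤ if a.1 = o then m - 1 else 0) :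
    (L.map fun a => a.2.2).sum ≤ (m - 1) * (L.countP fun a => a.1 = o) := by
  induction L with
  | nil => simp
  | cons a L ih =>
    have ha := h a List.mem_cons_self
    have hL := ih fun b hb => h b (List.mem_cons_of_mem a hb)
    simp only [List.map_cons, List.sum_cons, List.countP_cons, decide_eq_true_eq]
    split_ifs at ha ⊢ <;> push_cast <;> linarith

variable {R : Type*} [Ring R] [Algebra ℂ R] {M : Type*} [AddCommGroup M] [Module R M]

/-- A word of loop generators with at most one letter in row `o` kills `v` as soon as its total
mode is at least `m - 1` plus its length, if `v` is killed by the modes `≥ m` of row `o` and by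
the modes `≥ 1` of the other rows. -/
theorem prod_smul_eq_zero_of_sum_modes_ge (m : ℤ) (hm : 1 ≤ m) (o : ι)
    (x : ι → ι → ℤ → R) (c : ι → ι → ι → ι → ℤ → ℂ)
    (hcomm : ∀ (i j k l : ι) (p q : ℤ),
      x i j p * x k l q - x k l q * x i j p =
        (if j = k then x i l (p + q) else 0) - (if l = i then x k j (p + q) else 0) +
          (if p + q = 0 then (c i j k l p) • (1 : R) else 0))
    (v : M) (hv : ∀ (i j : ι) (s : ℤ), (if i = o then m else 1) ≤ s → x i j s • v = 0)
    (L : List (ι × ι × ℤ)) (hne : L ≠ []) (hcount : L.countP (fun a => a.1 = o) ≤ 1)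
    (hsum : m - 1 + L.length ≤ (L.map fun a => a.2.2).sum) :
    (L.map fun a => x a.1 a.2.1 a.2.2).prod • v = 0 := by
  induction hk : L.length using Nat.strong_induction_on generalizing L with
  | _ k ih =>
  subst hk
  obtain ⟨a, ha, hgood⟩ : ∃ a ∈ L, (if a.1 = o then m else 1) ≤ a.2.2 := by
    by_contra! hbad
    have hle := sum_modes_le_mul_countP m o L fun a ha => by
      have := hbad a ha
      split_ifs at this ⊢ <;> omega
    have hlen : 0 < L.length := List.length_pos_iff.mpr hne
    have hc : ((L.countP fun a => a.1 = o : ℕ) : ℤ) ≤ 1 := by exact_mod_cast hcount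
    nlinarith
  obtain ⟨A, B, rfl⟩ := List.append_of_mem ha
  obtain ⟨i, j, p⟩ := a
  clear ha hne
  induction B generalizing A with
  | nil => simp [mul_smul, hv i j p hgood]
  | cons b B ihB =>
    obtain ⟨i', j', q⟩ := b
    simp only [List.countP_append, List.countP_cons, List.map_append, List.map_cons,
      List.sum_append, List.sum_cons, List.length_append, List.length_cons,
      decide_eq_true_eq] at hcount hsum ih
    push_cast at hsum
    have hswap := ihB (A ++ [(i', j', q)])
      (by simpa [List.countP_append, List.countP_cons, add_comm, add_left_comm, add_assoc]
        using hcount)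
      (by simp; linarith)
      (fun k' hk' L' h₁ h₂ h₃ h₄ => ih k' (by simp at hk'; omega) L' h₁ h₂ h₃ h₄)
    have merge (i₀ j₀ : ι) (hrow : i₀ = i ∨ i₀ = i') :
        ((A.map fun a => x a.1 a.2.1 a.2.2).prod * (x i₀ j₀ (p + q) *
          (B.map fun a => x a.1 a.2.1 a.2.2).prod)) • v = 0 := by
      have := ih (A ++ (i₀, j₀, p + q) :: B).length (by simp)
        (A ++ (i₀, j₀, p + q) :: B) (by simp)
        (by
          simp only [List.countP_append, List.countP_cons, decide_eq_true_eq]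
          rcases hrow with rfl | rfl <;> split_ifs at hcount ⊢ <;> omega)
        (by simp; linarith) rfl
      simpa using this
    have central (h0 : p + q = 0) :
        ((A.map fun a => x a.1 a.2.1 a.2.2).prod *
          (B.map fun a => x a.1 a.2.1 a.2.2).prod) • v = 0 := by
      have hAB : A ++ B ≠ [] := by
        intro h
        obtain ⟨rfl, rfl⟩ := List.append_eq_nil_iff.mp h
        simp at hsum
        linarith
      have := ih (A ++ B).length (by simp) (A ++ B) hAB
        (by simp only [List.countP_append]; omega)
        (by simp; linarith) rfl
      simpa using this
    have hcentral : ((A.map fun a => x a.1 a.2.1 a.2.2).prod *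
        ((if p + q = 0 then c i j i' j' p • (1 : R) else 0) *
          (B.map fun a => x a.1 a.2.1 a.2.2).prod)) • v = 0 := by
      split_ifs with h0
      · rw [smul_one_mul, mul_smul_comm, Algebra.smul_def, mul_smul, central h0, smul_zero]
      · simp
    have hab := eq_add_of_sub_eq (hcomm i j i' j' p q)
    simp only [List.append_assoc, List.map_append, List.map_cons,
      List.prod_append, List.prod_cons, List.cons_append, List.nil_append] at hswap ⊢
    rw [← mul_assoc (x i j p), hab]
    simp only [add_mul, sub_mul, mul_add, mul_sub, add_smul, sub_smul]
    rw [mul_assoc (x i' j' q), hswap, add_zero, hcentral, add_zero]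
    split_ifs <;> simp [merge i j' (.inl rfl), merge i' j (.inr rfl)]

/-- If at most one value of `f` satisfies `P`, then at most one entry of `List.ofFn f` does. -/
theorem countP_ofFn_le_one {α : Type*} (P : α → Prop) [DecidablePred P] {k : ℕ} (f : Fin k → α)
    (h : ∀ t t', P (f t) → P (f t') → t = t') :
    (List.ofFn f).countP (fun a => P a) ≤ 1 := by
  rw [List.ofFn_eq_map, List.countP_map, List.countP_eq_length_filter,
    ← List.toFinset_card_of_nodup ((List.nodup_finRange k).filter _), Finset.card_le_one]
  intro t ht t' ht'
  simp only [List.mem_toFinset, List.mem_filter, Function.comp_apply, decide_eq_true_eq] at ht ht'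
  exact h t t' ht.2 ht'.2

end

/-- Let `x : Fin (n+1) → Fin (n+1) → ℤ → R` satisfy the commutation relations of a central
extension of the loop algebra `gl_{n+1}(ℂ[t,t⁻¹])` (with central terms given by some cocycle
`c`), let `r` encode the subalgebra `𝔨_m⁰`, and let `v` be a vector killed by `x i j s` for all
`s ≥ r i j`. Then for every `ℓ ∈ {1, …, n+1}`, every `1 ≤ k ≤ ℓ`, every list of pairs with at
most one row index equal to the last index, all negative `u₁, …, uₖ` summing to `−ℓ`, and all
`s₁, …, sₖ` with `s₁ + ⋯ + sₖ ≥ m + ℓ − 1`, the ordered product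
`x i₁ j₁ (u₁+s₁+1) ⋯ x iₖ jₖ (uₖ+sₖ+1)` kills `v` (i.e. the Fourier coefficients `S_{ℓ,[N]}`
of the Chervov–Molev–Talalaev vectors annihilate `v` for `N ≥ m + ℓ − 1`). -/
theorem cmt_operators_annihilate (n : ℕ) (m : ℤ) (hm : 1 ≤ m)
    {R : Type*} [Ring R] [Algebra ℂ R]
    (x : Fin (n + 1) → Fin (n + 1) → ℤ → R)
    (c : Fin (n + 1) → Fin (n + 1) → Fin (n + 1) → Fin (n + 1) → ℤ → ℂ)
    (hcomm : ∀ (i j k' l : Fin (n + 1)) (p q : ℤ),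
      x i j p * x k' l q - x k' l q * x i j p =
        (if j = k' then x i l (p + q) else 0) - (if l = i then x k' j (p + q) else 0) +
          (if p + q = 0 then (c i j k' l p) • (1 : R) else 0))
    (r : Fin (n + 1) → Fin (n + 1) → ℤ)
    (hr : ∀ i j : Fin (n + 1),
      r i j = if i = Fin.last n then m else if j = Fin.last n then 0 else 1)
    {M : Type*} [AddCommGroup M] [Module R M]
    (v : M)
    (hv : ∀ (i j : Fin (n + 1)) (s : ℤ), r i j ≤ s → x i j s • v = 0)
    (ℓ : ℕ) (hℓ1 : 1 ≤ ℓ) (hℓn : ℓ ≤ n + 1)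
    (k : ℕ) (hk1 : 1 ≤ k) (hkℓ : k ≤ ℓ)
    (ii jj : Fin k → Fin (n + 1))
    (hone : ∀ t t' : Fin k, ii t = Fin.last n → ii t' = Fin.last n → t = t')
    (u : Fin k → ℤ) (hu : ∀ t, u t < 0) (husum : ∑ t, u t = -(ℓ : ℤ))
    (s : Fin k → ℤ) (hssum : m + (ℓ : ℤ) - 1 ≤ ∑ t, s t) :
    (List.ofFn fun t : Fin k => x (ii t) (jj t) (u t + s t + 1)).prod • v = 0 := by
  have hlen : ∑ t, (u t + s t + 1) = -(ℓ : ℤ) + ∑ t, s t + k := by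
    simp [Finset.sum_add_distrib, husum]
  have hprod := prod_smul_eq_zero_of_sum_modes_ge m hm (Fin.last n) x c hcomm v
    (fun i j p hp => hv i j p (by rw [hr]; split_ifs at hp ⊢ <;> omega))
    (List.ofFn fun t => (ii t, jj t, u t + s t + 1))
    (by simp [List.ofFn_eq_nil_iff]; omega)
    (countP_ofFn_le_one (fun a : Fin (n + 1) × Fin (n + 1) × ℤ => a.1 = Fin.last n) _ hone)
    (by simp only [List.map_ofFn, List.length_ofFn, List.sum_ofFn, Function.comp_apply]; omega)
  simpa [List.map_ofFn, Function.comp_def] using hprod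
end
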